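/- Let 0 = p_0 < p_1 < … < p_m = n and let s : [n] → [m] be the monotone surjection with s(j) = r whenever p_{r−1} < j ≤ p_r. Let d be a decoration of [m] and let Γ = Γ_1 ⊔ … ⊔ Γ_k be a d-decorated ε-noncrossing partition of [m]. Then the partition s^{-1}(Γ) of [n] with blocks s^{-1}(Γ_1), …, s^{-1}(Γ_k) and decoration d∘s is an ε-noncrossing (d∘s)-decorated partition of [n]. -/

import Mathlib

/-!
Common setup: ε-noncrossing partitions (Ebrahimi-Fard–Patras–Speicher).

A partition of `[n]` is encoded as a `Setoid (Fin n)` (blocks = equivalence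
classes).  A decoration is a map `d : Fin n → I`, and `ε : I → I → Bool` is a
symmetric family of values in `{0,1}` (with `true` playing the role of `1`).
-/

namespace EpsNC

open scoped Classical

variable {I : Type*}

/-- The partition `σ(Γ)`: blocks are the images under `σ` of the blocks of `Γ`. -/
def permSetoid {n : ℕ} (σ : Equiv.Perm (Fin n)) (Γ : Setoid (Fin n)) : Setoid (Fin n) :=
  Setoid.comap (⇑σ⁻¹) Γ

/-- The decoration `σ(d)`, `σ(d)(i) = d(σ⁻¹(i))`. -/
def permDec {n : ℕ} (σ : Equiv.Perm (Fin n)) (d : Fin n → I) : Fin n → I :=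
  d ∘ ⇑σ⁻¹

/-- The adjacent transposition `(i, j)` with `j = i + 1` is an allowed move for the
`d`-decorated partition `Γ` if `ε_{d(i)d(j)} = 1` and either `d(i) ≠ d(j)`, or
`d(i) = d(j)` and `i`, `j` lie in different blocks of `Γ`. -/
def IsAllowedMove {n : ℕ} (ε : I → I → Bool) (d : Fin n → I) (Γ : Setoid (Fin n))
    (i j : Fin n) : Prop :=
  (i : ℕ) + 1 = (j : ℕ) ∧ ε (d i) (d j) = true ∧ (d i ≠ d j ∨ ¬ Γ i j)

/-- `σ` is an allowed permutation of the `d`-decorated partition `Γ` if it is a product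
`τ_{i_k} ⋯ τ_{i_1}` of adjacent transpositions, each being an allowed move for the
(decorated) partition obtained by applying the previous ones. -/
inductive AllowedPerm {n : ℕ} (ε : I → I → Bool) (d : Fin n → I) (Γ : Setoid (Fin n)) :
    Equiv.Perm (Fin n) → Prop
  | one : AllowedPerm ε d Γ 1
  | step {σ : Equiv.Perm (Fin n)} (i j : Fin n) :
      AllowedPerm ε d Γ σ →
      IsAllowedMove ε (permDec σ d) (permSetoid σ Γ) i j →
      AllowedPerm ε d Γ (Equiv.swap i j * σ)

/-- Standardization of the restriction of a map on `Fin n` to a subset `S`,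
via the unique order isomorphism `Fin S.card ≃o S`. -/
noncomputable def restrictFun {n : ℕ} {α : Type*} (f : Fin n → α) (S : Finset (Fin n)) :
    Fin S.card → α :=
  fun k => f (S.orderIsoOfFin rfl k).1

/-- Standardization of the restriction of a partition of `Fin n` to a subset `S`,
via the unique order isomorphism `Fin S.card ≃o S` (blocks are the nonempty
intersections of blocks with `S`, transported to `Fin S.card`). -/
noncomputable def restrictSetoid {n : ℕ} (Γ : Setoid (Fin n)) (S : Finset (Fin n)) :
    Setoid (Fin S.card) :=
  Setoid.comap (fun k => (S.orderIsoOfFin rfl k).1) Γ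

/-- The block of the partition `Γ` containing `b`. -/
noncomputable def blockOf {n : ℕ} (Γ : Setoid (Fin n)) (b : Fin n) : Finset (Fin n) :=
  Finset.univ.filter (fun x => Γ b x)

/-- A subset of `Fin n` is an interval of consecutive integers iff it is order-connected. -/
def IsIntervalBlock {n : ℕ} (S : Finset (Fin n)) : Prop :=
  ∀ ⦃x y z : Fin n⦄, x ∈ S → z ∈ S → x ≤ y → y ≤ z → y ∈ S

/-- A `d`-decorated partition `Γ` of `[n]` is ε-noncrossing if it can be reduced to the
empty partition by a finite sequence of reductions: a reduction consists of an allowed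
permutation `σ` of `Γ` together with a block of `σ(Γ)` which is an interval of
consecutive integers; it deletes that block and standardizes the result. -/
inductive IsEpsNC (ε : I → I → Bool) : {n : ℕ} → (Fin n → I) → Setoid (Fin n) → Prop
  | empty (d : Fin 0 → I) (Γ : Setoid (Fin 0)) : IsEpsNC ε d Γ
  | reduce {n : ℕ} {d : Fin n → I} {Γ : Setoid (Fin n)}
      (σ : Equiv.Perm (Fin n)) (b : Fin n)
      (hσ : AllowedPerm ε d Γ σ)
      (hint : IsIntervalBlock (blockOf (permSetoid σ Γ) b))
      (hrec : IsEpsNC ε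
        (restrictFun (permDec σ d) (blockOf (permSetoid σ Γ) b)ᶜ)
        (restrictSetoid (permSetoid σ Γ) (blockOf (permSetoid σ Γ) b)ᶜ)) :
      IsEpsNC ε d Γ

/-- A partition of `[n]` is noncrossing if there are no `i < j < k < l` with `i, k` in
one block and `j, l` in a different block. -/
def IsNoncrossing {n : ℕ} (Γ : Setoid (Fin n)) : Prop :=
  ∀ ⦃i j k l : Fin n⦄, i < j → j < k → k < l → Γ i k → Γ j l → Γ i j

/-- The set of blocks of a partition, as finsets. -/
noncomputable def blocksSet {n : ℕ} (Γ : Setoid (Fin n)) : Set (Finset (Fin n)) :=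
  {B | ∃ b : Fin n, B = blockOf Γ b}

/-- `k_ε^Γ(a₁, …, aₙ)`: the product over the blocks `Γ_j = {x₁ < … < x_m}` of `Γ` of the
cumulants `κ(a_{x₁}, …, a_{x_m})` (with the corresponding decorations). -/
noncomputable def cumPart {K A : Type*} [Field K] {n : ℕ}
    (κ : (m : ℕ) → (Fin m → I) → (Fin m → A) → K)
    (d : Fin n → I) (Γ : Setoid (Fin n)) (a : Fin n → A) : K :=
  ∏ᶠ B ∈ blocksSet Γ, κ B.card (restrictFun d B) (restrictFun a B)

/-- `φ^Γ(a₁, …, aₙ)`: the product over the blocks `Γ_j = {x₁ < … < x_m}` of `Γ` of the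
moments `φ(a_{x₁} ⋯ a_{x_m})`. -/
noncomputable def phiPart {K A : Type*} [Field K] [Ring A] [Algebra K A] {n : ℕ}
    (φ : A →ₗ[K] K) (Γ : Setoid (Fin n)) (a : Fin n → A) : K :=
  ∏ᶠ B ∈ blocksSet Γ, φ (List.ofFn (restrictFun a B)).prod

/-- The set of setoids on a finite type is finite (needed so that the sums over sets of
ε-noncrossing partitions below, taken with `∑ᶠ`, are honest finite sums). -/
instance {n : ℕ} : Finite (Setoid (Fin n)) :=
  Finite.of_injective (fun Γ : Setoid (Fin n) => ⇑Γ)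
    (fun _ _ h => Setoid.ext fun x y => iff_of_eq (congrFun (congrFun h x) y))

/-- `κ` is the family of ε-cumulants of the noncommutative probability space `(A, φ)`
with distinguished subalgebras `(As i)_{i ∈ I}`: for every `n`, every decoration
`d : Fin n → I` and every tuple `a` with `a j ∈ As (d j)`, the moment-cumulant relation
`φ(a₁ ⋯ aₙ) = Σ_{Γ ∈ P^{d,ε}_n} k_ε^Γ(a)` holds.  (This relation determines `κ`
uniquely on such tuples.) -/
def CumulantFamily {K A : Type*} [Field K] [Ring A] [Algebra K A]
    (ε : I → I → Bool) (φ : A →ₗ[K] K) (As : I → Subalgebra K A)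
    (κ : (m : ℕ) → (Fin m → I) → (Fin m → A) → K) : Prop :=
  ∀ (m : ℕ) (d : Fin m → I) (a : Fin m → A), (∀ j, a j ∈ As (d j)) →
    φ (List.ofFn a).prod = ∑ᶠ Γ ∈ {Γ : Setoid (Fin m) | IsEpsNC ε d Γ}, cumPart κ d Γ a

/-- The tuple `d = (d 1, …, d n)` lies in `I_n^ε`: whenever `d k = d l` for `k < l`,
there is `k < p < l` with `d p ≠ d k` and `ε_{d(p)d(k)} = 0`. -/
def MemIeps {n : ℕ} (ε : I → I → Bool) (d : Fin n → I) : Prop :=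
  ∀ k l : Fin n, k < l → d k = d l →
    ∃ p : Fin n, k < p ∧ p < l ∧ d p ≠ d k ∧ ε (d p) (d k) = false

/-- The subalgebras `(As i)_{i ∈ I}` are ε-independent in `(A, φ)`. -/
def EpsIndependent {K A : Type*} [Field K] [Ring A] [Algebra K A]
    (ε : I → I → Bool) (φ : A →ₗ[K] K) (As : I → Subalgebra K A) : Prop :=
  (∀ i j : I, i ≠ j → ε i j = true →
    ∀ a ∈ As i, ∀ b ∈ As j, a * b = b * a) ∧
  (∀ (n : ℕ) (d : Fin n → I) (a : Fin n → A), MemIeps ε d →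
    (∀ k, a k ∈ As (d k)) → (∀ k, φ (a k) = 0) → φ (List.ofFn a).prod = 0)

/-- The join of two partitions in the lattice `P^{d,ε}_n` of ε-noncrossing partitions:
the finest ε-noncrossing partition coarser than both (computed as the meet, in the full
partition lattice, of all ε-noncrossing upper bounds). -/
noncomputable def epsJoin {n : ℕ} (ε : I → I → Bool) (d : Fin n → I)
    (Φ Ψ : Setoid (Fin n)) : Setoid (Fin n) :=
  sInf {Θ : Setoid (Fin n) | IsEpsNC ε d Θ ∧ Φ ≤ Θ ∧ Ψ ≤ Θ}

@[simp]
theorem permSetoid_rel {n : ℕ} (σ : Equiv.Perm (Fin n)) (Γ : Setoid (Fin n)) (x y : Fin n) :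
    permSetoid σ Γ x y ↔ Γ (σ⁻¹ x) (σ⁻¹ y) :=
  Iff.rfl

theorem restrictSetoid_rel {n : ℕ} (Γ : Setoid (Fin n)) (S : Finset (Fin n))
    (k l : Fin S.card) :
    restrictSetoid Γ S k l ↔ Γ (S.orderIsoOfFin rfl k).1 (S.orderIsoOfFin rfl l).1 :=
  Iff.rfl

theorem AllowedPerm.mul {n : ℕ} {ε : I → I → Bool} {d : Fin n → I} {Γ : Setoid (Fin n)}
    {σ τ : Equiv.Perm (Fin n)} (hσ : AllowedPerm ε d Γ σ)
    (hτ : AllowedPerm ε (permDec σ d) (permSetoid σ Γ) τ) : AllowedPerm ε d Γ (τ * σ) := by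
  induction hτ with
  | one => simpa using hσ
  | @step ρ i j _ hmove ih =>
    rw [mul_assoc]
    refine .step i j ih ?_
    have hdec : permDec (ρ * σ) d = permDec ρ (permDec σ d) := by
      ext x; simp [permDec]
    have hset : permSetoid (ρ * σ) Γ = permSetoid ρ (permSetoid σ Γ) := by
      ext x y; simp
    rwa [hdec, hset]

/-- Pulling back along an adjacent transposition creates no inversion other than that of the
transposed pair. -/
theorem swap_lt_swap_of_lt {n : ℕ} {i j x y : Fin n} (hij : (i : ℕ) + 1 = j) (hxy : x < y)
    (hne : ¬ (x = i ∧ y = j)) : Equiv.swap i j x < Equiv.swap i j y := by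
  simp only [Equiv.swap_apply_def]
  simp only [Fin.ext_iff, Fin.lt_def] at *
  split_ifs <;> omega

/-- If every inversion of `g` is between commuting values, then the partition pulled back
along `g` can be sorted by allowed moves. -/
theorem exists_allowedPerm_monotone {n m : ℕ} {ε : I → I → Bool} {e : Fin m → I}
    {Γ : Setoid (Fin m)} (g : Fin n → Fin m)
    (hg : ∀ x y, x < y → g y < g x →
      ε (e (g x)) (e (g y)) = true ∧ (e (g x) ≠ e (g y) ∨ ¬ Γ (g x) (g y))) :
    ∃ τ, AllowedPerm ε (e ∘ g) (Setoid.comap g Γ) τ ∧ Monotone (g ∘ ⇑τ⁻¹) := by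
  induction hG : toLex g using WellFoundedLT.induction generalizing g with
  | ind G ih =>
    subst hG
    by_cases hmono : Monotone g
    · exact ⟨1, .one, by simpa using hmono⟩
    obtain ⟨i, j, hij, hlt⟩ : ∃ i j : Fin n, (i : ℕ) + 1 = j ∧ g j < g i := by
      cases n with
      | zero => exact absurd (fun x => x.elim0) hmono
      | succ n =>
        rw [Fin.monotone_iff_le_succ] at hmono
        push Not at hmono
        obtain ⟨i, hi⟩ := hmono
        exact ⟨i.castSucc, i.succ, by simp, hi⟩
    have hij' : i < j := by rw [Fin.lt_def]; omega
    obtain ⟨τ, hτ, hτmono⟩ := ih (toLex (g ∘ Equiv.swap i j)) (Pi.lex_desc hij'.le hlt)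
      (g ∘ Equiv.swap i j) (fun x y hxy hyx => by
        refine hg _ _ (swap_lt_swap_of_lt hij hxy ?_) hyx
        rintro ⟨rfl, rfl⟩
        simp only [Function.comp_apply, Equiv.swap_apply_left, Equiv.swap_apply_right] at hyx
        exact hlt.asymm hyx) rfl
    have hswap : AllowedPerm ε (e ∘ g) (Setoid.comap g Γ) (Equiv.swap i j) := by
      have h := AllowedPerm.step (ε := ε) (d := e ∘ g) (Γ := Setoid.comap g Γ) i j .one
        ⟨hij, hg i j hij' hlt⟩
      rwa [mul_one] at h
    refine ⟨τ * Equiv.swap i j, hswap.mul ?_, ?_⟩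
    · convert hτ using 1
      · simp [permDec, Function.comp_assoc]
      · ext x y; simp [Setoid.comap_rel]
    · convert hτmono using 1
      ext x; simp

/-- The only pair whose order is strictly reversed by an adjacent transposition is the
transposed one. -/
theorem eq_and_eq_of_swap_lt_swap {n : ℕ} {i j x y : Fin n} (hij : (i : ℕ) + 1 = j)
    (hxy : x ≤ y) (h : Equiv.swap i j y < Equiv.swap i j x) : x = i ∧ y = j := by
  by_contra hne
  rcases hxy.eq_or_lt with rfl | hlt
  · exact h.false
  · exact h.asymm (swap_lt_swap_of_lt hij hlt hne)

/-- An allowed permutation of `Γ` lifts to an allowed permutation of the preimage of `Γ`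
under a monotone map. -/
theorem AllowedPerm.exists_lift {n m : ℕ} {ε : I → I → Bool} {d : Fin m → I}
    {Γ : Setoid (Fin m)} {σ : Equiv.Perm (Fin m)} (hσ : AllowedPerm ε d Γ σ)
    {s : Fin n → Fin m} (hs : Monotone s) :
    ∃ τ, AllowedPerm ε (d ∘ s) (Setoid.comap s Γ) τ ∧ Monotone (σ ∘ s ∘ ⇑τ⁻¹) := by
  induction hσ with
  | one => exact ⟨1, .one, by simpa using hs⟩
  | @step σ i j _ hmove ih =>
    obtain ⟨τ, hτ, hmono⟩ := ih
    obtain ⟨hij, hε, hne⟩ := hmove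
    obtain ⟨ρ, hρ, hρmono⟩ := exists_allowedPerm_monotone (ε := ε)
      (e := permDec (Equiv.swap i j * σ) d) (Γ := permSetoid (Equiv.swap i j * σ) Γ)
      (Equiv.swap i j ∘ σ ∘ s ∘ ⇑τ⁻¹) (fun x y hxy hyx => by
        obtain ⟨hx, hy⟩ := eq_and_eq_of_swap_lt_swap hij (hmono hxy.le) hyx
        have hx' : (Equiv.swap i j ∘ σ ∘ s ∘ ⇑τ⁻¹) x = j := by
          rw [Function.comp_apply, hx, Equiv.swap_apply_left]
        have hy' : (Equiv.swap i j ∘ σ ∘ s ∘ ⇑τ⁻¹) y = i := by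
          rw [Function.comp_apply, hy, Equiv.swap_apply_right]
        rw [hx', hy']
        simpa [permDec] using And.intro hε hne)
    refine ⟨ρ * τ, hτ.mul ?_, ?_⟩
    · convert hρ using 1
      · ext x; simp [permDec]
      · ext x y; simp [Setoid.comap_rel]
    · convert hρmono using 1
      ext x; simp

/-- Let `s : [n] → [m]` be a monotone surjection (equivalently, the map
determined by `0 = p₀ < p₁ < … < p_m = n` via `s(j) = r` for `p_{r-1} < j ≤ p_r`) and
let `Γ` be a `d`-decorated ε-noncrossing partition of `[m]`.  Then the preimage
partition `s⁻¹(Γ)` of `[n]` (whose blocks are the preimages of the blocks of `Γ`), with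
decoration `d ∘ s`, is ε-noncrossing. -/
theorem isEpsNC_comap_monotone_surjective {I : Type*} (ε : I → I → Bool)
    (hsym : ∀ i j : I, ε i j = ε j i)
    {n m : ℕ} (s : Fin n → Fin m) (hmono : Monotone s) (hsurj : Function.Surjective s)
    (d : Fin m → I) (Γ : Setoid (Fin m)) (hΓ : IsEpsNC ε d Γ) :
    IsEpsNC ε (d ∘ s) (Setoid.comap s Γ) := by
  induction hΓ generalizing n with
  | empty d Γ =>
    obtain rfl : n = 0 := by
      cases n with
      | zero => rfl
      | succ n => exact (s 0).elim0
    exact .empty _ _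
  | @reduce m d Γ σ b hσ hint _ ih =>
    obtain ⟨τ, hτ, hmono'⟩ := hσ.exists_lift hmono
    set t : Fin n → Fin m := σ ∘ s ∘ ⇑τ⁻¹ with ht
    have hsurj' : Function.Surjective t :=
      σ.surjective.comp (hsurj.comp (τ⁻¹).surjective)
    have hdec : permDec τ (d ∘ s) = permDec σ d ∘ t := by
      ext x; simp [permDec, ht]
    have hset : permSetoid τ (Setoid.comap s Γ) = Setoid.comap t (permSetoid σ Γ) := by
      ext x y; simp [Setoid.comap_rel, ht]
    obtain ⟨c, rfl⟩ := hsurj' b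
    refine .reduce τ c hτ ?_ ?_ <;> rw [hset]
    · intro x y z hx hz hxy hyz
      simp only [blockOf, Finset.mem_filter_univ, Setoid.comap_rel] at hx hz ⊢
      simpa [blockOf] using hint (y := t y) (by simpa [blockOf] using hx)
        (by simpa [blockOf] using hz) (hmono' hxy) (hmono' hyz)
    · rw [hdec]
      set B := (blockOf (permSetoid σ Γ) (t c))ᶜ with hB
      set C := (blockOf (Setoid.comap t (permSetoid σ Γ)) c)ᶜ with hC
      have hmem : ∀ x, t x ∈ B ↔ x ∈ C := by
        intro x; simp [hB, hC, blockOf, Setoid.comap_rel]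
      let u : Fin C.card → Fin B.card := fun k =>
        (B.orderIsoOfFin rfl).symm
          ⟨t (C.orderIsoOfFin rfl k).1, (hmem _).2 (C.orderIsoOfFin rfl k).2⟩
      have hu : ∀ k, (B.orderIsoOfFin rfl (u k)).1 = t (C.orderIsoOfFin rfl k).1 := by
        intro k; simp only [u, OrderIso.apply_symm_apply]
      have humono : Monotone u := fun k l hkl =>
        (B.orderIsoOfFin rfl).symm.monotone
          (hmono' ((C.orderIsoOfFin rfl).monotone hkl))
      have husurj : Function.Surjective u := by
        intro k
        obtain ⟨x, hx⟩ := hsurj' (B.orderIsoOfFin rfl k).1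
        have hxC : x ∈ C := (hmem x).1 (hx ▸ (B.orderIsoOfFin rfl k).2)
        refine ⟨(C.orderIsoOfFin rfl).symm ⟨x, hxC⟩, (B.orderIsoOfFin rfl).injective ?_⟩
        ext1
        rw [hu, OrderIso.apply_symm_apply, hx]
      convert ih u humono husurj using 1
      · ext k; simp only [restrictFun, Function.comp_apply, hu]
      · ext k l; simp only [restrictSetoid_rel, Setoid.comap_rel, hu]

end EpsNC
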